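/- Fix an integer N ≥ 3 and parameters ρ, γ, σ_D, ψ, φ > 0, and set δ := √(ρ² + 2(N−2)(ρ+ψ)(ρ+φ)). Consider the algebraic system in unknowns (a, λ, c) ∈ ℝ³: (i) (ρ/2)·a/(N−1) = a²/(λ(N−1)) − γσ_D²/2; (ii) −ρ·((N−2)/(N(N−1)))λ = a/(N−1) + ((N−2)/(N(N−1)))(ψ+φ)λ + c; (iii) ρ(((N−2)/(N(N−1)))(a + λφ) + c) = −2a²/(N(N−1)λ) − ((N−2)/(N(N−1)))φ²λ − φ(a/(N−1) + c). Then the triple a = −(N−1)γσ_D²/δ, λ = ((N−1)/(N−2))·(ργσ_D²/((ρ+ψ)(ρ+φ)))·(1/δ + 1/ρ), c = −(ρ(ρ+ψ+φ)/((ρ+ψ)(ρ+φ)))·(γσ_D²/N)·(1/δ + 1/ρ) + γσ_D²/δ satisfies the system together with λ > 0 and 2a/λ < ρ, and it is the unique triple with these properties. -/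

import Mathlib

/-- The HJB coefficient-matching system (62)–(64) characterizing a linear
symmetric Nash equilibrium in the dynamic market-making game, in the unknowns
`(a, λ, c)`. -/
def HJBSystem (N : ℕ) (rho gam sigD psi phi a lam c : ℝ) : Prop :=
  (rho / 2) * a / (N - 1 : ℝ) = a ^ 2 / (lam * (N - 1 : ℝ)) - gam * sigD ^ 2 / 2 ∧
  -(rho * (((N - 2 : ℝ) / ((N : ℝ) * (N - 1 : ℝ))) * lam))
    = a / (N - 1 : ℝ) + ((N - 2 : ℝ) / ((N : ℝ) * (N - 1 : ℝ))) * (psi + phi) * lam + c ∧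
  rho * (((N - 2 : ℝ) / ((N : ℝ) * (N - 1 : ℝ))) * (a + lam * phi) + c)
    = -(2 * a ^ 2 / ((N : ℝ) * (N - 1 : ℝ) * lam))
      - ((N - 2 : ℝ) / ((N : ℝ) * (N - 1 : ℝ))) * phi ^ 2 * lam
      - phi * (a / (N - 1 : ℝ) + c)

/-- For `λ > 0` the coefficient-matching system is equivalent to a polynomial one, in which `c` is
an explicit function of `(a, λ)` and `a / λ` is a root of a quadratic. -/
lemma hjbSystem_iff {N : ℕ} (hN : 3 ≤ N) {rho gam sigD psi phi a lam c : ℝ} (hlam : 0 < lam) :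
    HJBSystem N rho gam sigD psi phi a lam c ↔
      rho * a * lam = 2 * a ^ 2 - gam * sigD ^ 2 * (N - 1) * lam ∧
      c = -(a / (N - 1)) - (N - 2) / (N * (N - 1)) * (rho + psi + phi) * lam ∧
      2 * a ^ 2 - 2 * rho * a * lam - (N - 2) * ((rho + psi) * (rho + phi)) * lam ^ 2 = 0 := by
  have hN' : (3 : ℝ) ≤ N := by exact_mod_cast hN
  have hn : (N : ℝ) ≠ 0 := by linarith
  have hn1 : (N : ℝ) - 1 ≠ 0 := by linarith
  have hl := hlam.ne'
  unfold HJBSystem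
  have h1 : (rho / 2) * a / (N - 1 : ℝ) = a ^ 2 / (lam * (N - 1 : ℝ)) - gam * sigD ^ 2 / 2 ↔
      rho * a * lam = 2 * a ^ 2 - gam * sigD ^ 2 * (N - 1) * lam := by
    field_simp
  have h2 : -(rho * (((N - 2 : ℝ) / ((N : ℝ) * (N - 1 : ℝ))) * lam))
      = a / (N - 1 : ℝ) + ((N - 2 : ℝ) / ((N : ℝ) * (N - 1 : ℝ))) * (psi + phi) * lam + c ↔
      c = -(a / (N - 1)) - (N - 2) / (N * (N - 1)) * (rho + psi + phi) * lam := by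
    constructor <;> intro h <;> linarith
  rw [h1, h2]
  refine and_congr_right fun _ => and_congr_right fun hc => ?_
  subst hc
  rw [← sub_eq_zero]
  have h3 : rho * (((N - 2 : ℝ) / ((N : ℝ) * (N - 1 : ℝ))) * (a + lam * phi)
        + (-(a / (N - 1)) - (N - 2) / (N * (N - 1)) * (rho + psi + phi) * lam))
      - (-(2 * a ^ 2 / ((N : ℝ) * (N - 1 : ℝ) * lam))
        - ((N - 2 : ℝ) / ((N : ℝ) * (N - 1 : ℝ))) * phi ^ 2 * lam
        - phi * (a / (N - 1 : ℝ)
          + (-(a / (N - 1)) - (N - 2) / (N * (N - 1)) * (rho + psi + phi) * lam)))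
      = (2 * a ^ 2 - 2 * rho * a * lam - (N - 2) * ((rho + psi) * (rho + phi)) * lam ^ 2)
        / (N * (N - 1) * lam) := by
    field_simp
    ring
  rw [h3, div_eq_zero_iff, or_iff_left (by positivity)]

/-- For `N ≥ 3`, `ρ, γ, σ_D, ψ, φ > 0` and `δ := √(ρ² + 2(N−2)(ρ+ψ)(ρ+φ))`, the triple
`a = −(N−1)γσ_D²/δ`,
`λ = ((N−1)/(N−2))·(ργσ_D²/((ρ+ψ)(ρ+φ)))·(1/δ + 1/ρ)`,
`c = −(ρ(ρ+ψ+φ)/((ρ+ψ)(ρ+φ)))·(γσ_D²/N)·(1/δ + 1/ρ) + γσ_D²/δ`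
satisfies the HJB coefficient-matching system together with `λ > 0` and
`2a/λ < ρ`, and it is the unique triple with these properties. -/
theorem stmt_11 (N : ℕ) (hN : 3 ≤ N) (rho gam sigD psi phi : ℝ)
    (hrho : 0 < rho) (hgam : 0 < gam) (hsigD : 0 < sigD)
    (hpsi : 0 < psi) (hphi : 0 < phi) :
    let del : ℝ := Real.sqrt (rho ^ 2 + 2 * (N - 2 : ℝ) * (rho + psi) * (rho + phi))
    let a0 : ℝ := -((N - 1 : ℝ) * gam * sigD ^ 2 / del)
    let lam0 : ℝ := ((N - 1 : ℝ) / (N - 2 : ℝ))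
      * (rho * gam * sigD ^ 2 / ((rho + psi) * (rho + phi))) * (1 / del + 1 / rho)
    let c0 : ℝ := -((rho * (rho + psi + phi) / ((rho + psi) * (rho + phi)))
      * (gam * sigD ^ 2 / N) * (1 / del + 1 / rho)) + gam * sigD ^ 2 / del
    (HJBSystem N rho gam sigD psi phi a0 lam0 c0 ∧ 0 < lam0 ∧ 2 * a0 / lam0 < rho) ∧
    ∀ a lam c : ℝ,
      HJBSystem N rho gam sigD psi phi a lam c → 0 < lam → 2 * a / lam < rho →
        a = a0 ∧ lam = lam0 ∧ c = c0 := by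
  intro del a0 lam0 c0
  have hN' : (3 : ℝ) ≤ N := by exact_mod_cast hN
  have hn : (0 : ℝ) < N := by linarith
  have hn1 : (0 : ℝ) < (N : ℝ) - 1 := by linarith
  have hn2 : (0 : ℝ) < (N : ℝ) - 2 := by linarith
  have hP : 0 < rho + psi := by positivity
  have hF : 0 < rho + phi := by positivity
  have hpos : 0 < rho ^ 2 + 2 * (N - 2 : ℝ) * (rho + psi) * (rho + phi) := by positivity
  have hdel : 0 < del := Real.sqrt_pos.2 hpos
  have hsq : del ^ 2 = rho ^ 2 + 2 * (N - 2 : ℝ) * (rho + psi) * (rho + phi) :=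
    Real.sq_sqrt hpos.le
  clear_value del
  have ha0 : a0 * del = -((N - 1) * gam * sigD ^ 2) := by
    simp only [a0]
    field_simp
  have hlam0 : 0 < lam0 := by
    simp only [lam0]
    positivity
  have hrel : (rho + del) * a0 = -((N - 2) * ((rho + psi) * (rho + phi)) * lam0) := by
    simp only [a0, lam0]
    field_simp
  have hratio : 2 * a0 = (rho - del) * lam0 := by
    have h : (rho + del) * (2 * a0) = (rho + del) * ((rho - del) * lam0) := by
      linear_combination 2 * hrel + lam0 * hsq
    exact mul_left_cancel₀ (by positivity) h
  have hc0 : c0 = -(a0 / (N - 1)) - (N - 2) / (N * (N - 1)) * (rho + psi + phi) * lam0 := by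
    simp only [a0, lam0, c0]
    field_simp
    ring
  clear_value a0 lam0 c0
  refine ⟨⟨(hjbSystem_iff hN hlam0).2 ⟨?_, hc0, ?_⟩, hlam0, ?_⟩, fun a lam c h hlam hadm => ?_⟩
  · linear_combination (-a0) * hratio + lam0 * ha0
  · linear_combination (a0 - (rho + del) / 2 * lam0) * hratio + lam0 ^ 2 / 2 * hsq
  · rw [div_lt_iff₀ hlam0, hratio]
    nlinarith
  · obtain ⟨h1, h2, h3⟩ := (hjbSystem_iff hN hlam).1 h
    rw [div_lt_iff₀ hlam] at hadm
    have hx : 2 * a = (rho - del) * lam := by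
      have hprod : (2 * a - (rho - del) * lam) * (2 * a - (rho + del) * lam) = 0 := by
        linear_combination 2 * h3 - lam ^ 2 * hsq
      rcases mul_eq_zero.1 hprod with h | h
      · linarith
      · nlinarith [mul_pos hdel hlam]
    have haeq : a = a0 := by
      have h : lam * del * a = lam * del * a0 := by
        linear_combination h1 + a * hx - lam * ha0
      exact mul_left_cancel₀ (by positivity) h
    subst haeq
    have hlameq : lam = lam0 := by
      have hne : rho - del ≠ 0 := by
        have : 0 < (N - 2 : ℝ) * (rho + psi) * (rho + phi) := by positivity
        intro h
        nlinarith
      exact mul_left_cancel₀ hne (hx.symm.trans hratio)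
    subst hlameq
    exact ⟨rfl, rfl, h2.trans hc0.symm⟩
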